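/- Let d > 0 be real and let x be a real number with 0 < x < 1/π. For each integer n ≥ 1 define V_n(d) by: V_n(d) = (d/sinh(d/2)) · (∏_{j=1}^{k−1}(d² + (2j)²π²)) / (2(n−1)!) if n = 2k is even, and V_n(d) = (1/cosh(d/2)) · (∏_{j=1}^{k}(d² + (2j−1)²π²)) / (2(n−1)!) if n = 2k+1 is odd (empty products equal 1). Then the series ∑_{n=1}^{∞} V_n(d)·xⁿ converges, with sum equal to (x/√(1 − π²x²)) · sinh(d/2 + (d/π)·arcsin(πx)) / sinh(d). -/

import Mathlib

open MeasureTheory Real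

/-- The Mirzakhani volume `V_{𝔸ₙ}(d)` of the moduli space of hyperbolic `n`-crowns with
neck length `d`: for `n = 2k` even it is
`(d/sinh(d/2)) · ∏_{j=1}^{k-1}(d² + (2j)²π²) / (2(n-1)!)`, and for `n = 2k+1` odd it is
`(1/cosh(d/2)) · ∏_{j=1}^{k}(d² + (2j-1)²π²) / (2(n-1)!)`. -/
noncomputable def crownVol (n : ℕ) (d : ℝ) : ℝ :=
  if n % 2 = 0 then
    d / Real.sinh (d / 2) *
      (∏ j ∈ Finset.Icc 1 (n / 2 - 1), (d ^ 2 + (2 * (j : ℝ)) ^ 2 * Real.pi ^ 2)) /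
      (2 * (Nat.factorial (n - 1) : ℝ))
  else
    1 / Real.cosh (d / 2) *
      (∏ j ∈ Finset.Icc 1 (n / 2), (d ^ 2 + (2 * (j : ℝ) - 1) ^ 2 * Real.pi ^ 2)) /
      (2 * (Nat.factorial (n - 1) : ℝ))

/-- The two-step recurrence `m(m+1) V_{m+2}(d) = (d² + m²π²) V_m(d)`, with `m = n + 1`. -/
lemma crownVol_add_two (n : ℕ) (d : ℝ) :
    ((n : ℝ) + 1) * (n + 2) * crownVol (n + 3) d =
      (d ^ 2 + ((n : ℝ) + 1) ^ 2 * π ^ 2) * crownVol (n + 1) d := by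
  have hfac : ((n + 2).factorial : ℝ) = (n + 2) * ((n + 1) * n.factorial) := by
    rw [Nat.factorial_succ, Nat.factorial_succ]; push_cast; ring
  have hn : (n.factorial : ℝ) ≠ 0 := by positivity
  have h1 : (n : ℝ) + 1 ≠ 0 := by positivity
  have h2 : (n : ℝ) + 2 ≠ 0 := by positivity
  unfold crownVol
  simp only [Nat.add_sub_cancel, show n + 3 - 1 = n + 2 from rfl, hfac]
  rcases Nat.even_or_odd' n with ⟨k, rfl | rfl⟩
  · rw [if_neg (by omega), if_neg (by omega), show (2 * k + 3) / 2 = k + 1 by omega,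
      show (2 * k + 1) / 2 = k by omega, Finset.prod_Icc_succ_top (by omega)]
    push_cast at *
    generalize 1 / cosh (d / 2) = c
    generalize ∏ j ∈ Finset.Icc 1 k, (d ^ 2 + (2 * (j : ℝ) - 1) ^ 2 * π ^ 2) = p
    field_simp
    ring
  · rw [if_pos (by omega), if_pos (by omega), show (2 * k + 1 + 3) / 2 - 1 = k + 1 by omega,
      show (2 * k + 1 + 1) / 2 - 1 = k by omega, Finset.prod_Icc_succ_top (by omega)]
    push_cast at *
    generalize d / sinh (d / 2) = c
    generalize ∏ j ∈ Finset.Icc 1 k, (d ^ 2 + (2 * (j : ℝ)) ^ 2 * π ^ 2) = p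
    field_simp
    ring

lemma summable_of_abs_le_mul_pow {a : ℕ → ℝ} {C : ℝ} {k : ℕ}
    (ha : ∀ n, |a n| ≤ C * ((n : ℝ) + 1) ^ k) {t : ℝ} (ht : |t| < 1) :
    Summable fun n => a n * t ^ n := by
  obtain ⟨r, htr, hr1⟩ := exists_between ht
  have hr0 : 0 < r := (abs_nonneg t).trans_lt htr
  have hs : Summable fun n : ℕ => C * ((n : ℝ) + 1) ^ k * r ^ n := by
    have h := (summable_nat_add_iff 1).2 (summable_pow_mul_geometric_of_norm_lt_one k
      (r := r) (by rwa [norm_eq_abs, abs_of_pos hr0]))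
    refine (h.mul_left (C / r)).congr fun n => ?_
    push_cast
    rw [pow_succ]
    field_simp
  refine hs.of_norm_bounded fun n => ?_
  rw [norm_eq_abs, abs_mul, abs_pow]
  have := (abs_nonneg (a n)).trans (ha n)
  gcongr
  exact ha n

lemma abs_succ_mul_le {a : ℕ → ℝ} {C : ℝ} {k : ℕ} (ha : ∀ n, |a n| ≤ C * ((n : ℝ) + 1) ^ k)
    (n : ℕ) : |((n : ℝ) + 1) * a (n + 1)| ≤ C * 2 ^ k * ((n : ℝ) + 1) ^ (k + 1) := by
  have hC : 0 ≤ C := by simpa using (abs_nonneg (a 0)).trans (ha 0)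
  have hn : (0 : ℝ) ≤ n := n.cast_nonneg
  rw [abs_mul, abs_of_nonneg (by positivity)]
  calc ((n : ℝ) + 1) * |a (n + 1)| ≤ (n + 1) * (C * ((n + 1 : ℕ) + 1 : ℝ) ^ k) := by
        gcongr; exact ha _
    _ ≤ (n + 1) * (C * (2 * (n + 1)) ^ k) := by gcongr; push_cast; linarith
    _ = _ := by rw [mul_pow]; ring

/-- Termwise differentiation of a power series with polynomially bounded coefficients. -/
lemma hasDerivAt_tsum_mul_pow {a : ℕ → ℝ} {C : ℝ} {k : ℕ}
    (ha : ∀ n, |a n| ≤ C * ((n : ℝ) + 1) ^ k) {t : ℝ} (ht : |t| < 1) :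
    HasDerivAt (fun t => ∑' n, a n * t ^ n) (∑' n : ℕ, ((n : ℝ) + 1) * a (n + 1) * t ^ n) t := by
  obtain ⟨r, htr, hr1⟩ := exists_between ht
  have hr0 : 0 < r := (abs_nonneg t).trans_lt htr
  have hb : ∀ n : ℕ, |(|((n : ℝ) + 1) * a (n + 1)|)| ≤ C * 2 ^ k * ((n : ℝ) + 1) ^ (k + 1) :=
    fun n => by rw [abs_abs]; exact abs_succ_mul_le ha n
  have hu : Summable fun n : ℕ => |(n : ℝ) * a n| * r ^ (n - 1) := by
    refine (summable_nat_add_iff 1).1 ?_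
    simpa using summable_of_abs_le_mul_pow hb (by rwa [abs_of_pos hr0] : |r| < 1)
  have hbound : ∀ (n : ℕ) (y : ℝ), y ∈ Metric.ball (0 : ℝ) r →
      ‖a n * (n * y ^ (n - 1))‖ ≤ |(n : ℝ) * a n| * r ^ (n - 1) := fun n y hy => by
    have hy' : |y| < r := by simpa using hy
    rw [norm_eq_abs, show a n * (n * y ^ (n - 1)) = n * a n * y ^ (n - 1) by ring, abs_mul, abs_pow]
    gcongr
  have ht' : t ∈ Metric.ball (0 : ℝ) r := by simpa using htr
  have h := hasDerivAt_tsum_of_isPreconnected hu Metric.isOpen_ball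
    (convex_ball (0 : ℝ) r).isPreconnected
    (fun n y _ => (hasDerivAt_pow n y).const_mul (a n)) hbound ht'
    (summable_of_abs_le_mul_pow ha ht) ht'
  refine h.congr_deriv ?_
  rw [(hu.of_norm_bounded fun n => hbound n t ht').tsum_eq_zero_add]
  simp only [Nat.cast_zero, zero_mul, mul_zero, zero_add, Nat.add_sub_cancel]
  refine tsum_congr fun n => ?_
  push_cast
  ring

lemma exists_abs_le_of_recurrence {y : ℕ → ℝ} {α : ℝ}
    (hy : ∀ n : ℕ, ((n : ℝ) + 1) * (n + 2) * y (n + 2) = (n ^ 2 + α ^ 2) * y n) :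
    ∃ C, ∀ n, |y n| ≤ C := by
  obtain ⟨N, hN⟩ := exists_nat_ge (α ^ 2)
  have hle : ∀ i ∈ Finset.range (N + 2), |y i| ≤ ∑ i ∈ Finset.range (N + 2), |y i| :=
    fun i hi => Finset.single_le_sum (f := fun i => |y i|) (fun j _ => abs_nonneg (y j)) hi
  refine ⟨∑ i ∈ Finset.range (N + 2), |y i|, fun n => ?_⟩
  induction n using Nat.strong_induction_on with
  | _ n ih =>
    by_cases hn : n < N + 2
    · exact hle n (Finset.mem_range.2 hn)
    · obtain ⟨m, rfl⟩ : ∃ m, n = m + 2 := ⟨n - 2, by omega⟩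
      refine le_trans ?_ (ih m (by omega))
      have hm : (N : ℝ) ≤ m := by exact_mod_cast (by omega : N ≤ m)
      have hm0 : (0 : ℝ) ≤ m := m.cast_nonneg
      have h := congrArg abs (hy m)
      rw [abs_mul, abs_mul ((m : ℝ) ^ 2 + α ^ 2), abs_of_nonneg (by positivity),
        abs_of_nonneg (by positivity : 0 ≤ (m : ℝ) ^ 2 + α ^ 2)] at h
      have hpos : 0 < ((m : ℝ) + 1) * (m + 2) := by positivity
      refine le_of_mul_le_mul_left (h.trans_le ?_) hpos
      refine mul_le_mul_of_nonneg_right ?_ (abs_nonneg _)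
      nlinarith

/-- A power series `F` whose coefficients satisfy the recurrence solves
`(1 - t²) F'' - t F' = α² F` on the unit interval. -/
lemma ode_of_recurrence {y : ℕ → ℝ} {α C : ℝ}
    (hy : ∀ n : ℕ, ((n : ℝ) + 1) * (n + 2) * y (n + 2) = (n ^ 2 + α ^ 2) * y n)
    (hC : ∀ n, |y n| ≤ C * ((n : ℝ) + 1) ^ 0) {t : ℝ} (ht : |t| < 1) :
    (1 - t ^ 2) * (∑' n : ℕ, ((n : ℝ) + 1) * (((n + 1 : ℕ) + 1) * y (n + 1 + 1)) * t ^ n) -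
      t * (∑' n : ℕ, ((n : ℝ) + 1) * y (n + 1) * t ^ n) = α ^ 2 * ∑' n, y n * t ^ n := by
  have h0 := (summable_of_abs_le_mul_pow hC ht).hasSum
  have hC1 := abs_succ_mul_le hC
  have h1 := (summable_of_abs_le_mul_pow hC1 ht).hasSum
  have hC2 := abs_succ_mul_le hC1
  have h2 := (summable_of_abs_le_mul_pow hC2 ht).hasSum
  have h1' : HasSum (fun n : ℕ => (n : ℝ) * y n * t ^ n)
      (t * (∑' n : ℕ, ((n : ℝ) + 1) * y (n + 1) * t ^ n)) := by
    rw [← hasSum_nat_add_iff' 1]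
    simpa [pow_succ, mul_comm, mul_left_comm, mul_assoc] using h1.mul_left t
  have h2' : HasSum (fun n : ℕ => (n : ℝ) * (n - 1) * y n * t ^ n)
      (t ^ 2 * (∑' n : ℕ, ((n : ℝ) + 1) * (((n + 1 : ℕ) + 1) * y (n + 1 + 1)) * t ^ n)) := by
    rw [← hasSum_nat_add_iff' 2]
    have h := h2.mul_left (t ^ 2)
    rw [show (fun n : ℕ => t ^ 2 * (((n : ℝ) + 1) * (((n + 1 : ℕ) + 1) * y (n + 1 + 1)) * t ^ n)) =
      fun n : ℕ => ((n + 2 : ℕ) : ℝ) * ((n + 2 : ℕ) - 1) * y (n + 2) * t ^ (n + 2) from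
        funext fun n => by push_cast; ring] at h
    simpa [Finset.sum_range_succ] using h
  have h := ((h2.sub h2').sub h1').unique ((h0.mul_left (α ^ 2)).congr_fun ?_)
  · rw [← h]; ring
  · intro n
    have := hy n
    push_cast
    linear_combination (t ^ n) * this

/-- First integral of `(1 - t²) F'' - t F' = β² F`. -/
lemma sqrt_mul_deriv_add_eq {F F' F'' : ℝ → ℝ} {β : ℝ}
    (hF : ∀ t, |t| < 1 → HasDerivAt F (F' t) t) (hF' : ∀ t, |t| < 1 → HasDerivAt F' (F'' t) t)
    (hode : ∀ t, |t| < 1 → (1 - t ^ 2) * F'' t - t * F' t = β ^ 2 * F t)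
    {t : ℝ} (ht : |t| < 1) :
    √(1 - t ^ 2) * F' t + β * F t = (F' 0 + β * F 0) * exp (β * arcsin t) := by
  set G : ℝ → ℝ := fun t => (√(1 - t ^ 2) * F' t + β * F t) * exp (-(β * arcsin t)) with hG
  have hderiv : ∀ s ∈ Metric.ball (0 : ℝ) 1, HasDerivAt G 0 s := fun s hs => by
    have hs' : |s| < 1 := by simpa using hs
    obtain ⟨hs1, hs2⟩ := abs_lt.1 hs'
    have hpos : 0 < 1 - s ^ 2 := by nlinarith
    have hsq : √(1 - s ^ 2) ^ 2 = 1 - s ^ 2 := sq_sqrt hpos.le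
    have hne : √(1 - s ^ 2) ≠ 0 := (sqrt_pos.2 hpos).ne'
    have hroot : HasDerivAt (fun t : ℝ => √(1 - t ^ 2)) (-s / √(1 - s ^ 2)) s := by
      convert (((hasDerivAt_pow 2 s).const_sub 1).sqrt hpos.ne') using 1
      field_simp
      norm_num
      ring
    have harc := (((hasDerivAt_arcsin hs1.ne' hs2.ne).const_mul β).neg).exp
    have h := ((hroot.mul (hF' s hs')).add ((hF s hs').const_mul β)).mul harc
    refine h.congr_deriv ?_
    have := hode s hs'
    simp only [Pi.add_apply, Pi.mul_apply, Pi.neg_apply]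
    rw [← hsq] at this
    field_simp
    linear_combination exp (-(β * arcsin s)) * this
  have h0 : (0 : ℝ) ∈ Metric.ball (0 : ℝ) 1 := by simp
  have ht' : t ∈ Metric.ball (0 : ℝ) 1 := by simpa using ht
  have hconst : G t = G 0 :=
    Metric.isOpen_ball.is_const_of_deriv_eq_zero (convex_ball (0 : ℝ) 1).isPreconnected
      (fun s hs => (hderiv s hs).differentiableAt.differentiableWithinAt)
      (fun s hs => (hderiv s hs).deriv) ht' h0
  simp only [hG] at hconst
  norm_num at hconst
  rw [← hconst, mul_assoc, ← exp_add]
  simp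

/-- If `F = ∑ yₙ tⁿ` satisfies the recurrence with `y₀ = cosh c / α` and `y₁ = sinh c`, then
`F' = sinh (c + α arcsin t) / √(1 - t²)`. -/
lemma hasSum_sinh_add_mul_arcsin {y : ℕ → ℝ} {α c : ℝ}
    (hy : ∀ n : ℕ, ((n : ℝ) + 1) * (n + 2) * y (n + 2) = (n ^ 2 + α ^ 2) * y n)
    (hy0 : α * y 0 = cosh c) (hy1 : y 1 = sinh c) {t : ℝ} (ht : |t| < 1) :
    HasSum (fun n : ℕ => ((n : ℝ) + 1) * y (n + 1) * t ^ n)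
      (sinh (c + α * arcsin t) / √(1 - t ^ 2)) := by
  obtain ⟨C, hC'⟩ := exists_abs_le_of_recurrence hy
  have hC : ∀ n : ℕ, |y n| ≤ C * ((n : ℝ) + 1) ^ 0 := by simpa using hC'
  have hC1 := abs_succ_mul_le hC
  have hF := fun t (ht : |t| < 1) => hasDerivAt_tsum_mul_pow hC ht
  have hF' := fun t (ht : |t| < 1) => hasDerivAt_tsum_mul_pow hC1 ht
  have hode := fun t (ht : |t| < 1) => ode_of_recurrence hy hC ht
  have hp := sqrt_mul_deriv_add_eq hF hF' hode ht
  have hm := sqrt_mul_deriv_add_eq (β := -α) hF hF' (by simpa only [neg_sq] using hode) ht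
  have e0 : ∑' n, y n * (0 : ℝ) ^ n = y 0 := by
    rw [tsum_eq_single 0 fun n hn => by simp [hn]]; simp
  have e1 : ∑' n : ℕ, ((n : ℝ) + 1) * y (n + 1) * (0 : ℝ) ^ n = y 1 := by
    rw [tsum_eq_single 0 fun n hn => by simp [hn]]; simp
  simp only [e0, e1] at hp hm
  have hpos : 0 < √(1 - t ^ 2) := sqrt_pos.2 (by
    obtain ⟨h1, h2⟩ := abs_lt.1 ht
    nlinarith)
  have hs := (summable_of_abs_le_mul_pow hC1 ht).hasSum
  convert hs using 1
  rw [div_eq_iff hpos.ne', sinh_add, sinh_eq (α * arcsin t), cosh_eq (α * arcsin t)]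
  rw [hy0, hy1] at hp
  rw [neg_mul, neg_mul, neg_mul, hy0, hy1] at hm
  linear_combination (-(hp + hm)) / 2

/-- The generating function `∑_{n≥1} V_{𝔸ₙ}(d) xⁿ` of Mirzakhani volumes of moduli
spaces of crowns equals `(x/√(1-π²x²)) · sinh(d/2 + (d/π) arcsin(πx)) / sinh d`. -/
theorem generating_function_crowns (d : ℝ) (hd : 0 < d) (x : ℝ) (hx0 : 0 < x)
    (hx1 : x < 1 / Real.pi) :
    HasSum (fun n : ℕ => crownVol (n + 1) d * x ^ (n + 1))
      (x / Real.sqrt (1 - Real.pi ^ 2 * x ^ 2) *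
        Real.sinh (d / 2 + d / Real.pi * Real.arcsin (Real.pi * x)) / Real.sinh d) := by
  have hpi := pi_pos
  have hsinh : 0 < sinh d := sinh_pos_iff.2 hd
  have hsinh2 : 0 < sinh (d / 2) := sinh_pos_iff.2 (by positivity)
  have hcosh2 : 0 < cosh (d / 2) := cosh_pos _
  have hdouble : sinh d = 2 * sinh (d / 2) * cosh (d / 2) := by
    rw [← sinh_two_mul]; ring_nf
  have ht : |π * x| < 1 := by
    rw [abs_of_pos (by positivity), mul_comm]
    exact (lt_div_iff₀ hpi).1 hx1
  let y : ℕ → ℝ := fun n => match n with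
    | 0 => cosh (d / 2) * π / d
    | n + 1 => sinh d * crownVol (n + 1) d / ((n + 1) * π ^ n)
  have hy : ∀ n : ℕ,
      ((n : ℝ) + 1) * (n + 2) * y (n + 2) = (n ^ 2 + (d / π) ^ 2) * y n := by
    rintro (_ | n)
    · simp only [y, crownVol, hdouble]
      norm_num
      field_simp
    · have := crownVol_add_two n d
      simp only [y]
      rw [show ((n + 2 : ℕ) : ℝ) + 1 = n + 3 by push_cast; ring, pow_add]
      push_cast
      have h1 : (n : ℝ) + 1 ≠ 0 := by positivity
      have h3 : (n : ℝ) + 3 ≠ 0 := by positivity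
      field_simp
      linear_combination (n + 3 : ℝ) * this
  have h := hasSum_sinh_add_mul_arcsin (c := d / 2) hy (by simp only [y]; field_simp)
    (by simp [y, crownVol, hdouble]; field_simp) ht
  rw [show x / √(1 - π ^ 2 * x ^ 2) * sinh (d / 2 + d / π * arcsin (π * x)) / sinh d =
    x / sinh d * (sinh (d / 2 + d / π * arcsin (π * x)) / √(1 - (π * x) ^ 2)) by
      rw [mul_pow]; ring]
  refine (h.mul_left (x / sinh d)).congr_fun fun n => ?_
  have h1 : (n : ℝ) + 1 ≠ 0 := by positivity
  simp only [y]
  field_simp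
  ring
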